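/- Let t, σ, θ > 0 with nθ > tσ, let m > 0 and γ > nmθ/(tσ). Let B_ρ ⊂ B_{ρ+r₀} ⊂ ℝⁿ be concentric balls with ρ, r₀ ≤ 1 and let f be measurable with |f|^γ ∈ L¹(B_{ρ+r₀}). Then the nonlinear potential P^{m,θ}_{t,σ}(f; x₀, r₀) := ∫₀^{r₀} s^σ ( ⨍_{B_s(x₀)} |f|^m )^{θ/t} ds/s satisfies sup_{x₀ ∈ B_ρ} P^{m,θ}_{t,σ}(f; x₀, r₀) ≤ c ‖f‖_{L^γ(B_{ρ+r₀})}^{mθ/t} with c = c(n, t, σ, m, θ, γ). -/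

import Mathlib

open MeasureTheory

/-- Jensen's inequality for the power `q ∈ [0, 1]`, for averages over a set of finite positive
measure. -/
theorem setAverage_rpow_le_rpow_setAverage {α : Type*} [MeasurableSpace α] {μ : Measure α}
    {s : Set α} (h0 : μ s ≠ 0) (htop : μ s ≠ ⊤) {u : α → ℝ} (hu : IntegrableOn u s μ)
    (hnn : ∀ x, 0 ≤ u x) {q : ℝ} (hq0 : 0 ≤ q) (hq1 : q ≤ 1) :
    ⨍ x in s, u x ^ q ∂μ ≤ (⨍ x in s, u x ∂μ) ^ q := by
  have hfin : IsFiniteMeasure (μ.restrict s) := ⟨by simpa using htop.lt_top⟩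
  have hint : IntegrableOn (fun x => u x ^ q) s μ := by
    refine Integrable.mono' ((integrable_const (1 : ℝ)).add hu)
      (hu.aestronglyMeasurable.aemeasurable.pow_const q).aestronglyMeasurable
      (.of_forall fun x => ?_)
    rw [Real.norm_of_nonneg (Real.rpow_nonneg (hnn x) q)]
    change u x ^ q ≤ 1 + u x
    rcases le_total (u x) 1 with h | h
    · linarith [Real.rpow_le_one (hnn x) h hq0, hnn x]
    · linarith [Real.rpow_le_self_of_one_le h hq1]
  exact (Real.concaveOn_rpow hq0 hq1).le_map_set_average
    (Real.continuous_rpow_const hq0).continuousOn isClosed_Ici h0 htop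
    (.of_forall hnn) hu hint

theorem volume_real_ball_eq_pow_mul {n : ℕ} (x : EuclideanSpace ℝ (Fin n)) {s : ℝ} (hs : 0 < s) :
    volume.real (Metric.ball x s)
      = s ^ n * volume.real (Metric.ball (0 : EuclideanSpace ℝ (Fin n)) 1) := by
  simp [Measure.real, Measure.addHaar_ball_of_pos volume x hs, ENNReal.toReal_mul,
    ENNReal.toReal_ofReal (pow_nonneg hs.le n)]

theorem setAverage_ball_rpow_le {n : ℕ} {m γ s : ℝ} (hm : 0 < m) (hmγ : m ≤ γ) (hs : 0 < s)
    {x : EuclideanSpace ℝ (Fin n)} {B : Set (EuclideanSpace ℝ (Fin n))}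
    (hsub : Metric.ball x s ⊆ B) {f : EuclideanSpace ℝ (Fin n) → ℝ}
    (hf : IntegrableOn (fun y => |f y| ^ γ) B) :
    ⨍ y in Metric.ball x s, |f y| ^ m
      ≤ ((∫ y in B, |f y| ^ γ) /
        (s ^ n * volume.real (Metric.ball (0 : EuclideanSpace ℝ (Fin n)) 1))) ^ (m / γ) := by
  have hγ : 0 < γ := hm.trans_le hmγ
  have hnn (y) : 0 ≤ |f y| ^ γ := Real.rpow_nonneg (abs_nonneg _) _
  have hpow (y) : |f y| ^ m = (|f y| ^ γ) ^ (m / γ) := by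
    rw [← Real.rpow_mul (abs_nonneg _), mul_div_cancel₀ _ hγ.ne']
  simp_rw [hpow]
  refine (setAverage_rpow_le_rpow_setAverage (Metric.measure_ball_pos volume x hs).ne'
    measure_ball_lt_top.ne (hf.mono_set hsub) hnn (by positivity)
    ((div_le_one hγ).2 hmγ)).trans ?_
  rw [setAverage_eq, volume_real_ball_eq_pow_mul x hs, smul_eq_mul, ← div_eq_inv_mul]
  have hI : 0 ≤ ∫ y in Metric.ball x s, |f y| ^ γ := integral_nonneg hnn
  gcongr
  exact .of_forall hnn

/-- Lemma 2.4 of the paper, boundedness of the nonlinear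
Havin–Mazya–Wolff type potential `P^{m,θ}_{t,σ}`. -/
theorem potential_bound (n : ℕ) (t σ θ m γ : ℝ)
    (ht : 0 < t) (hσ : 0 < σ) (hθ : 0 < θ) (hm : 0 < m)
    (hbal : t * σ < n * θ) (hγ : n * m * θ / (t * σ) < γ) :
    ∃ c : ℝ, 0 < c ∧
      ∀ (x_c : EuclideanSpace ℝ (Fin n)) (ρ r₀ : ℝ),
        0 < ρ → ρ ≤ 1 → 0 < r₀ → r₀ ≤ 1 →
        ∀ f : EuclideanSpace ℝ (Fin n) → ℝ,
          Integrable (fun x => |f x| ^ γ)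
            (volume.restrict (Metric.ball x_c (ρ + r₀))) →
          ∀ x₀ ∈ Metric.ball x_c ρ,
            (∫ s in (0:ℝ)..r₀,
                s ^ σ * (⨍ x in Metric.ball x₀ s, |f x| ^ m ∂volume) ^ (θ/t) / s)
              ≤ c * (∫ x in Metric.ball x_c (ρ + r₀), |f x| ^ γ ∂volume)
                  ^ (m * θ / (t * γ)) := by
  have htσ : 0 < t * σ := mul_pos ht hσ
  rw [div_lt_iff₀ htσ] at hγ
  have hmγ : m < γ := by
    refine lt_of_mul_lt_mul_right ?_ htσ.le
    nlinarith
  have hγ0 : 0 < γ := hm.trans hmγ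
  set κ := m * θ / (t * γ) with hκ
  have hδ : 0 < σ - n * κ := by
    have : n * κ < σ := by
      rw [hκ, ← mul_div_assoc, div_lt_iff₀ (by positivity)]
      linarith
    linarith
  set ω := volume.real (Metric.ball (0 : EuclideanSpace ℝ (Fin n)) 1)
  have hω : 0 < ω := ENNReal.toReal_pos (Metric.measure_ball_pos volume _ one_pos).ne'
    measure_ball_lt_top.ne
  refine ⟨1 / (ω ^ κ * (σ - n * κ)), by positivity, ?_⟩
  intro x_c ρ r₀ hρ _ hr hr1 f hf x₀ hx₀
  set I := ∫ x in Metric.ball x_c (ρ + r₀), |f x| ^ γ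
  have hI : 0 ≤ I := integral_nonneg fun x => Real.rpow_nonneg (abs_nonneg _) _
  have hexp : -1 < σ - n * κ - 1 := by linarith
  have hav (s : ℝ) : 0 ≤ ⨍ x in Metric.ball x₀ s, |f x| ^ m := by
    rw [setAverage_eq]
    exact smul_nonneg (by positivity)
      (integral_nonneg fun x => Real.rpow_nonneg (abs_nonneg _) _)
  have hbound : ∀ s ∈ Set.Ioc 0 r₀,
      s ^ σ * (⨍ x in Metric.ball x₀ s, |f x| ^ m) ^ (θ / t) / s
        ≤ I ^ κ / ω ^ κ * s ^ (σ - n * κ - 1) := by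
    rintro s ⟨hs, hsr⟩
    have hsub : Metric.ball x₀ s ⊆ Metric.ball x_c (ρ + r₀) :=
      Metric.ball_subset_ball' (by linarith [Metric.mem_ball.1 hx₀])
    calc s ^ σ * (⨍ x in Metric.ball x₀ s, |f x| ^ m) ^ (θ / t) / s
        ≤ s ^ σ * ((I / (s ^ n * ω)) ^ (m / γ)) ^ (θ / t) / s := by
          gcongr
          · exact hav s
          · exact setAverage_ball_rpow_le hm hmγ.le hs hsub hf
      _ = I ^ κ / ω ^ κ * s ^ (σ - n * κ - 1) := by
          rw [← Real.rpow_mul (by positivity), show m / γ * (θ / t) = κ by rw [hκ]; field_simp,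
            Real.div_rpow hI (by positivity), Real.mul_rpow (by positivity) hω.le,
            ← Real.rpow_natCast_mul hs.le, Real.rpow_sub_one hs.ne', Real.rpow_sub hs]
          field_simp
  calc _ ≤ ∫ s in (0 : ℝ)..r₀, I ^ κ / ω ^ κ * s ^ (σ - n * κ - 1) := by
        rw [intervalIntegral.integral_of_le hr.le, intervalIntegral.integral_of_le hr.le]
        refine integral_mono_of_nonneg ?_ ?_ ?_
        · filter_upwards [ae_restrict_mem measurableSet_Ioc] with s hs
          exact div_nonneg (mul_nonneg (Real.rpow_nonneg hs.1.le _)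
            (Real.rpow_nonneg (hav s) _)) hs.1.le
        · exact ((intervalIntegral.intervalIntegrable_rpow' hexp).const_mul _).1
        · filter_upwards [ae_restrict_mem measurableSet_Ioc] with s hs using hbound s hs
    _ = I ^ κ / ω ^ κ * (r₀ ^ (σ - n * κ) / (σ - n * κ)) := by
        rw [intervalIntegral.integral_const_mul, integral_rpow (.inl hexp), sub_add_cancel,
          Real.zero_rpow hδ.ne', sub_zero]
    _ ≤ I ^ κ / ω ^ κ * (1 / (σ - n * κ)) := by
        gcongr
        exact Real.rpow_le_one hr.le hr1 hδ.le
    _ = 1 / (ω ^ κ * (σ - n * κ)) * I ^ κ := by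
        field_simp
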